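/- arXiv:1409.6991 — 2 statements merged into one kernel-verified Lean document; each statement's English description precedes it below -/
import Mathlib

section
/- Small-gain fixed-point bound: Let ρ : ℝ≥0 → ℝ≥0 be of class K∞ and let s, c ≥ 0 be real numbers satisfying s ≤ (Id + ρ)⁻¹(s) + c. Then s ≤ (Id + ρ⁻¹)(c) = c + ρ⁻¹(c). -/
open scoped NNReal

/-- A function `γ : ℝ≥0 → ℝ≥0` is of class K if it is continuous, strictly
increasing, and `γ 0 = 0`. -/
def ClassK (γ : ℝ≥0 → ℝ≥0) : Prop := Continuous γ ∧ StrictMono γ ∧ γ 0 = 0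

/-- A function `ρ : ℝ≥0 → ℝ≥0` is of class K∞ if it is of class K and unbounded. -/
def ClassKInf (ρ : ℝ≥0 → ℝ≥0) : Prop :=
  ClassK ρ ∧ Filter.Tendsto ρ Filter.atTop Filter.atTop

/-- Small-gain fixed-point bound: if `ρ` is of class K∞, `σ` is the inverse
bijection of `Id + ρ`, `ρinv` the inverse bijection of `ρ`, and
`s ≤ (Id+ρ)⁻¹(s) + c`, then `s ≤ c + ρ⁻¹(c)`. -/
theorem small_gain_fixed_point_bound
    (ρ ρinv σ : ℝ≥0 → ℝ≥0)
    (hρ : ClassKInf ρ)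
    (hρinvl : Function.LeftInverse ρinv ρ)
    (hρinvr : Function.RightInverse ρinv ρ)
    (hσl : Function.LeftInverse σ (fun s => s + ρ s))
    (hσr : Function.RightInverse σ (fun s => s + ρ s))
    (s c : ℝ≥0) (h : s ≤ σ s + c) :
    s ≤ c + ρinv c := by
  have h1 : σ s + ρ (σ s) = s := hσr s
  have h2 : ρ (σ s) ≤ c := by
    have h3 : σ s + ρ (σ s) ≤ σ s + c := h1.le.trans h
    exact le_of_add_le_add_left h3
  have h4 : σ s ≤ ρinv c := by
    rw [← hρ.1.2.1.le_iff_le, hρinvr c]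
    exact h2
  calc s ≤ σ s + c := h
    _ ≤ ρinv c + c := by gcongr
    _ = c + ρinv c := add_comm _ _
end

section
/- ISS of the interconnection (signal form of the Remark): Under all the hypotheses and notation of the generalized small-gain theorem in signal form with s_l = d₁ = d₂ = D₁⁰ = D₂⁰ = 0 (so that the subsystems are IOS and the interconnection satisfies y₁(t) ≤ β₁′(X₁ + X₂, t) + (r₁ + r₃¹)(U₁ + U₂) and y₂(t) ≤ β₂′(X₁ + X₂, t) + (r₂ + r₃²)(U₁ + U₂)), suppose in addition that there are class KL functions β_{x1}, β_{x2} and class K functions γ_{x1}ʸ, γ_{x1}ᵘ, γ_{x2}ʸ, γ_{x2}ᵘ such that for all 0 ≤ t₀ ≤ t: x₁(t) ≤ β_{x1}(x₁(t₀), t − t₀) + γ_{x1}ʸ(sup_{s ∈ [t₀,t]} y₂(s)) + γ_{x1}ᵘ(U₁) and x₂(t) ≤ β_{x2}(x₂(t₀), t − t₀) + γ_{x2}ʸ(sup_{s ∈ [t₀,t]} y₁(s)) + γ_{x2}ᵘ(U₂). Then there exist a class KL function β_x and a class K function γ_x, depending only on the data above and not on the particular trajectory, such that for all t ≥ 0,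 x₁(t) + x₂(t) ≤ β_x(X₁ + X₂, t) + γ_x(U₁ + U₂). -/
open scoped NNReal

/-- A function `β : ℝ≥0 × ℝ≥0 → ℝ≥0` is of class KL if `β (·, t)` is of class K
for each `t`, and `β (s, ·)` is non-increasing and tends to `0` at `∞`. -/
def ClassKL (β : ℝ≥0 → ℝ≥0 → ℝ≥0) : Prop :=
  (∀ t : ℝ≥0, ClassK (fun s => β s t)) ∧
    (∀ s : ℝ≥0, Antitone (fun t => β s t) ∧
      Filter.Tendsto (fun t => β s t) Filter.atTop (nhds 0))

/-- `Ip ρ` is the pointwise sum `Id + ρ`. -/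
def Ip (ρ : ℝ≥0 → ℝ≥0) : ℝ≥0 → ℝ≥0 := fun s => s + ρ s

section helpers

lemma ClassK.mono {f : ℝ≥0 → ℝ≥0} (h : ClassK f) : Monotone f := h.2.1.monotone

lemma ClassK.add {f g : ℝ≥0 → ℝ≥0} (hf : ClassK f) (hg : ClassK g) :
    ClassK (fun s => f s + g s) :=
  ⟨hf.1.add hg.1, hf.2.1.add hg.2.1, by simp [hf.2.2, hg.2.2]⟩

lemma ClassK.comp {f g : ℝ≥0 → ℝ≥0} (hf : ClassK f) (hg : ClassK g) :
    ClassK (fun s => f (g s)) :=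
  ⟨hf.1.comp hg.1, hf.2.1.comp hg.2.1, by simp [hf.2.2, hg.2.2]⟩

lemma ClassK.id' : ClassK (fun s => s) := ⟨continuous_id, strictMono_id, rfl⟩

lemma ClassK.pos {f : ℝ≥0 → ℝ≥0} (hf : ClassK f) {s : ℝ≥0} (hs : 0 < s) : 0 < f s := by
  have := hf.2.1 hs
  rwa [hf.2.2] at this

lemma ClassK.two {f : ℝ≥0 → ℝ≥0} (hf : ClassK f) : ClassK (fun s => 2 * f s) := by
  simpa [two_mul] using hf.add hf

lemma ClassK.split {f : ℝ≥0 → ℝ≥0} (hf : ClassK f) (a b : ℝ≥0) :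
    f (a + b) ≤ f (2 * a) + f (2 * b) := by
  rcases le_total a b with h | h
  · exact (hf.mono (by rw [two_mul]; gcongr)).trans le_add_self
  · exact (hf.mono (by rw [two_mul]; gcongr)).trans le_self_add

lemma ClassK.small {f : ℝ≥0 → ℝ≥0} (hf : ClassK f) {η : ℝ≥0} (hη : 0 < η) :
    ∃ δ, 0 < δ ∧ f δ ≤ η := by
  have h := hf.1.tendsto 0
  rw [hf.2.2] at h
  have h2 : ∀ᶠ s in nhds (0 : ℝ≥0), f s < η := h.eventually (gt_mem_nhds hη)
  have h3 : ∀ᶠ s in nhdsWithin (0 : ℝ≥0) (Set.Ioi 0), f s < η := h2.filter_mono nhdsWithin_le_nhds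
  obtain ⟨δ, hδ, hδ'⟩ := (h3.and self_mem_nhdsWithin).exists
  exact ⟨δ, hδ', hδ.le⟩

lemma ClassKInf.inv {ρ ρi : ℝ≥0 → ℝ≥0} (h : ClassKInf ρ)
    (hl : Function.LeftInverse ρi ρ) (hr : Function.RightInverse ρi ρ) : ClassK ρi := by
  have hs : StrictMono ρi := by
    intro a b hab
    rw [← h.1.2.1.lt_iff_lt, hr a, hr b]
    exact hab
  refine ⟨hs.monotone.continuous_of_surjective hl.surjective, hs, ?_⟩
  have := hl 0
  rwa [h.1.2.2] at this

lemma ClassKL.small {β : ℝ≥0 → ℝ≥0 → ℝ≥0} (h : ClassKL β) (M : ℝ≥0) {η : ℝ≥0} (hη : 0 < η) :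
    ∃ T, ∀ s t, s ≤ M → T ≤ t → β s t ≤ η := by
  obtain ⟨T, hT⟩ := ((h.2 M).2.eventually (gt_mem_nhds hη)).exists
  exact ⟨T, fun s t hs ht => ((h.1 t).mono hs).trans (((h.2 M).1 ht).trans hT.le)⟩

set_option maxHeartbeats 1600000 in
lemma kl_majorant (P : ℝ≥0 → ℝ≥0 → ℝ≥0 → Prop) (σ : ℝ≥0 → ℝ≥0) (hσ : ClassK σ)
    (h1 : ∀ r t v, P r t v → v ≤ σ r)
    (h2 : ∀ R ε, 0 < ε → ∃ T, ∀ r t v, r ≤ R → T ≤ t → P r t v → v ≤ ε) :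
    ∃ β, ClassKL β ∧ ∀ r t v, P r t v → v ≤ β r t := by
  let S : ℝ≥0 → ℝ≥0 → Set ℝ≥0 := fun r t => {v | ∃ r' t', r' ≤ r ∧ t ≤ t' ∧ P r' t' v}
  let e : ℝ≥0 → ℝ≥0 → ℝ≥0 := fun r t => sSup (S r t)
  have hS : ∀ r t, BddAbove (S r t) := by
    rintro r t
    refine ⟨σ r, ?_⟩
    rintro v ⟨r', t', hr, -, hP⟩
    exact (h1 _ _ _ hP).trans (hσ.mono hr)
  have heσ : ∀ r t, e r t ≤ σ r := by
    intro r t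
    apply csSup_le'
    rintro v ⟨r', t', hr, -, hP⟩
    exact (h1 _ _ _ hP).trans (hσ.mono hr)
  have her : ∀ t, Monotone (fun r => e r t) := by
    intro t r s hrs
    apply csSup_le_csSup' (hS _ _)
    rintro v ⟨r', t', hr, ht, hP⟩
    exact ⟨r', t', hr.trans hrs, ht, hP⟩
  have het : ∀ r, Antitone (fun t => e r t) := by
    intro r t s hts
    apply csSup_le_csSup' (hS _ _)
    rintro v ⟨r', t', hr, ht, hP⟩
    exact ⟨r', t', hr, hts.trans ht, hP⟩
  have he0 : ∀ r ε, 0 < ε → ∃ T, ∀ t, T ≤ t → e r t ≤ ε := by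
    intro r ε hε
    obtain ⟨T, hT⟩ := h2 r ε hε
    refine ⟨T, fun t ht => csSup_le' ?_⟩
    rintro v ⟨r', t', hr, ht', hP⟩
    exact hT _ _ _ hr (ht.trans ht') hP
  have heP : ∀ r t v, P r t v → v ≤ e r t := fun r t v h =>
    le_csSup (hS _ _) ⟨r, t, le_rfl, le_rfl, h⟩
  let E : ℝ≥0 → ℝ → ℝ := fun t s => (e s.toNNReal t : ℝ)
  have hE : ∀ t, Monotone (E t) := fun t a b hab => by
    have := her t (Real.toNNReal_le_toNNReal hab)
    exact_mod_cast this
  have hEi : ∀ t (a b : ℝ), IntervalIntegrable (E t) MeasureTheory.volume a b :=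
    fun t a b => (hE t).intervalIntegrable
  have hEi' : ∀ t (r a b : ℝ), IntervalIntegrable (fun s => E t (r + s)) MeasureTheory.volume a b :=
    fun t r a b => Monotone.intervalIntegrable (fun x y hxy => hE t (by linarith))
  let J : ℝ≥0 → ℝ≥0 → ℝ := fun r t => ∫ s in (0:ℝ)..1, E t ((r:ℝ) + s)
  have hJge : ∀ r t, (e r t : ℝ) ≤ J r t := by
    intro r t
    have : ∫ s in (0:ℝ)..1, (e r t : ℝ) ≤ J r t := by
      apply intervalIntegral.integral_mono_on zero_le_one (by simp) (hEi' _ _ _ _)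
      intro x hx
      have := hE t (show (r:ℝ) ≤ r + x by linarith [hx.1])
      simpa [E] using this
    simpa using this
  have hJle : ∀ r t, J r t ≤ (e (r+1) t : ℝ) := by
    intro r t
    have : J r t ≤ ∫ s in (0:ℝ)..1, (e (r+1) t : ℝ) := by
      apply intervalIntegral.integral_mono_on zero_le_one (hEi' _ _ _ _) (by simp)
      intro x hx
      have := hE t (show (r:ℝ) + x ≤ ((r + 1 : ℝ≥0) : ℝ) by push_cast; linarith [hx.2])
      simpa only [E, Real.toNNReal_coe] using this
    simpa using this
  have hJr : ∀ t, Monotone (fun r => J r t) := by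
    intro t a b hab
    apply intervalIntegral.integral_mono_on zero_le_one (hEi' _ _ _ _) (hEi' _ _ _ _)
    intro x hx
    have : (a:ℝ) ≤ b := hab
    exact hE t (by linarith)
  have hJt : ∀ r, Antitone (fun t => J r t) := by
    intro r a b hab
    apply intervalIntegral.integral_mono_on zero_le_one (hEi' _ _ _ _) (hEi' _ _ _ _)
    intro x hx
    have := het (((r:ℝ) + x).toNNReal) hab
    exact_mod_cast this
  have hJc : ∀ t, Continuous (fun r => J r t) := by
    intro t
    have h0 : Continuous (fun b : ℝ => ∫ s in (0:ℝ)..b, E t s) :=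
      intervalIntegral.continuous_primitive (fun a b => hEi t a b) 0
    have : (fun r => J r t) = fun r : ℝ≥0 =>
        (∫ s in (0:ℝ)..((r:ℝ)+1), E t s) - ∫ s in (0:ℝ)..(r:ℝ), E t s := by
      funext r
      rw [intervalIntegral.integral_interval_sub_left (hEi _ _ _) (hEi _ _ _)]
      simp only [J]
      rw [intervalIntegral.integral_comp_add_left (fun s => E t s) (r:ℝ)]
      simp
    rw [this]
    exact (h0.comp (by fun_prop)).sub (h0.comp (by fun_prop))
  let Q : ℝ≥0 → ℝ≥0 → ℝ≥0 := fun r t => (J r t).toNNReal + (1 + t)⁻¹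
  have hQpos : ∀ r t, 0 < Q r t := fun r t => by
    have : (0:ℝ≥0) < (1 + t)⁻¹ := by positivity
    exact lt_of_lt_of_le this le_add_self
  refine ⟨fun r t => NNReal.sqrt (σ r * Q r t), ⟨fun t => ⟨?_, ?_, ?_⟩, fun r => ⟨?_, ?_⟩⟩, ?_⟩
  · exact NNReal.continuous_sqrt.comp
      (hσ.1.mul (Continuous.add (continuous_real_toNNReal.comp (hJc t)) continuous_const))
  · intro a b hab
    apply NNReal.sqrt_lt_sqrt.2
    have hQ : Q a t ≤ Q b t := by
      have := Real.toNNReal_le_toNNReal (hJr t hab.le)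
      simp only [Q]
      gcongr
    calc σ a * Q a t ≤ σ a * Q b t := by gcongr
      _ < σ b * Q b t := by
        have := hσ.2.1 hab
        have := hQpos b t
        gcongr
  · simp [hσ.2.2]
  · intro a b hab
    apply NNReal.sqrt_le_sqrt.2
    have := Real.toNNReal_le_toNNReal (hJt r hab)
    simp only [Q]
    gcongr
  · have hJ0 : Filter.Tendsto (fun t => (J r t).toNNReal) Filter.atTop (nhds 0) := by
      rw [← bot_eq_zero]
      apply tendsto_order.2 ⟨fun a ha => absurd ha not_lt_bot, fun a ha => ?_⟩
      rw [bot_eq_zero] at ha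
      obtain ⟨c, hc0, hca⟩ := exists_between ha
      obtain ⟨T, hT⟩ := he0 (r+1) c hc0
      filter_upwards [Filter.eventually_ge_atTop T] with t ht
      refine lt_of_le_of_lt ?_ hca
      refine Real.toNNReal_le_iff_le_coe.2 ((hJle r t).trans ?_)
      exact_mod_cast hT t ht
    have hI : Filter.Tendsto (fun t : ℝ≥0 => (1 + t)⁻¹) Filter.atTop (nhds 0) :=
      tendsto_inv_atTop_zero.comp
        (Filter.tendsto_atTop_mono (fun t : ℝ≥0 => (le_add_self : t ≤ 1 + t)) Filter.tendsto_id)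
    have h3 := (hJ0.add hI).const_mul (σ r)
    have h4 := (NNReal.continuous_sqrt.tendsto _).comp h3
    simp only [add_zero, mul_zero, NNReal.sqrt_zero] at h4
    exact h4
  · intro r t v hP
    apply NNReal.le_sqrt_iff_sq_le.2
    have a1 := h1 r t v hP
    have a2 : v ≤ Q r t := (heP r t v hP).trans
      ((show e r t ≤ (J r t).toNNReal from NNReal.le_toNNReal_of_coe_le (hJge r t)).trans le_self_add)
    rw [sq]
    gcongr

/-- One step of the small-gain iteration. -/
lemma one_step {γ₁ γ₂ ρ₁ ρ₂ ρ₁i ρ₂i : ℝ≥0 → ℝ≥0} (hγ₁ : Monotone γ₁)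
    (hρ₁ : Monotone ρ₁) (hi₁ : Monotone ρ₁i) (hi₂ : Monotone ρ₂i)
    (hl₁ : Function.LeftInverse ρ₁i ρ₁) (hl₂ : Function.LeftInverse ρ₂i ρ₂)
    (hsg : ∀ s : ℝ≥0, Ip ρ₁ (γ₁ (Ip ρ₂ (γ₂ s))) ≤ s)
    (a ε Y Y' : ℝ≥0) (h : Y' ≤ a + γ₁ (a + γ₂ Y)) :
    Y' ≤ max (a + ρ₁i (2 * a) + γ₁ (a + ρ₂i a)) (max ε (Y - min (ρ₁ (ε / 2) / 2) (ε / 2))) := by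
  by_cases hb : a ≤ ρ₂ (γ₂ Y)
  · set z := γ₁ (Ip ρ₂ (γ₂ Y)) with hz
    have hz1 : z + ρ₁ z ≤ Y := hsg Y
    have hY : Y' ≤ a + z := h.trans (by
      gcongr
      apply hγ₁
      simp only [Ip]
      rw [add_comm]
      gcongr)
    by_cases hc : ρ₁ z ≤ 2 * a
    · apply le_max_of_le_left
      have : z ≤ ρ₁i (2 * a) := by
        have := hi₁ hc
        rwa [hl₁] at this
      exact (hY.trans (by gcongr)).trans le_self_add
    · push Not at hc
      apply le_max_of_le_right
      by_cases hε : Y' ≤ ε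
      · exact le_max_of_le_left hε
      apply le_max_of_le_right
      push Not at hε
      have hm : min (ρ₁ (ε / 2) / 2) (ε / 2) ≤ ρ₁ z / 2 := by
        rcases le_total (ε / 2) z with h' | h'
        · have := hρ₁ h'
          exact (min_le_left _ _).trans (by gcongr)
        · refine (min_le_right _ _).trans ?_
          rw [← NNReal.coe_le_coe] at *
          rw [← NNReal.coe_lt_coe] at *
          push_cast at *
          linarith
      apply le_tsub_of_add_le_right
      rw [← NNReal.coe_le_coe] at *
      rw [← NNReal.coe_lt_coe] at *
      push_cast at *
      linarith
  · push Not at hb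
    apply le_max_of_le_left
    have : γ₂ Y ≤ ρ₂i a := by
      have := hi₂ hb.le
      rwa [hl₂] at this
    calc Y' ≤ a + γ₁ (a + γ₂ Y) := h
      _ ≤ a + γ₁ (a + ρ₂i a) := by gcongr; apply hγ₁; gcongr
      _ ≤ _ := by gcongr; exact le_self_add

lemma sup_le' {y : ℝ≥0 → ℝ≥0} {a b B : ℝ≥0} (h : ∀ s, a ≤ s → s ≤ b → y s ≤ B) :
    sSup (y '' Set.Icc a b) ≤ B := by
  apply csSup_le'
  rintro _ ⟨s, hs, rfl⟩
  exact h s hs.1 hs.2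

end helpers

/-- ISS of the interconnection (signal form of the Remark).  The data are those
of the generalized small-gain theorem in signal form with
`s_l = d₁ = d₂ = D₁⁰ = D₂⁰ = 0` (so the subsystems are IOS with UO), together
with ISS estimates for the subsystem states.  The conclusion furnishes a class
KL function `β_x` and a class K function `γ_x`, depending only on the data and
not on the particular trajectory, bounding the total state. -/
theorem ISS_of_interconnection
    (β₁ β₂ βx1 βx2 : ℝ≥0 → ℝ≥0 → ℝ≥0)
    (γ₁y γ₂y γ₁u γ₂u α₁0 α₂0 γx1y γx1u γx2y γx2u : ℝ≥0 → ℝ≥0)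
    (ρ₁ ρ₂ ρ₁inv ρ₂inv : ℝ≥0 → ℝ≥0)
    (hβ₁ : ClassKL β₁) (hβ₂ : ClassKL β₂)
    (hβx1 : ClassKL βx1) (hβx2 : ClassKL βx2)
    (hγ₁y : ClassK γ₁y) (hγ₂y : ClassK γ₂y)
    (hγ₁u : ClassK γ₁u) (hγ₂u : ClassK γ₂u)
    (hα₁0 : ClassK α₁0) (hα₂0 : ClassK α₂0)
    (hγx1y : ClassK γx1y) (hγx1u : ClassK γx1u)
    (hγx2y : ClassK γx2y) (hγx2u : ClassK γx2u)
    (hρ₁ : ClassKInf ρ₁) (hρ₂ : ClassKInf ρ₂)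
    (hρ₁invl : Function.LeftInverse ρ₁inv ρ₁)
    (hρ₁invr : Function.RightInverse ρ₁inv ρ₁)
    (hρ₂invl : Function.LeftInverse ρ₂inv ρ₂)
    (hρ₂invr : Function.RightInverse ρ₂inv ρ₂)
    (hsg₁ : ∀ s : ℝ≥0, Ip ρ₂ (γ₂y (Ip ρ₁ (γ₁y s))) ≤ s)
    (hsg₂ : ∀ s : ℝ≥0, Ip ρ₁ (γ₁y (Ip ρ₂ (γ₂y s))) ≤ s) :
    ∃ βx : ℝ≥0 → ℝ≥0 → ℝ≥0, ∃ γx : ℝ≥0 → ℝ≥0,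
      ClassKL βx ∧ ClassK γx ∧
      ∀ (x₁ x₂ y₁ y₂ : ℝ≥0 → ℝ≥0) (X₁ X₂ U₁ U₂ : ℝ≥0),
        (∀ t : ℝ≥0, BddAbove (x₁ '' Set.Icc 0 t) ∧ BddAbove (x₂ '' Set.Icc 0 t) ∧
          BddAbove (y₁ '' Set.Icc 0 t) ∧ BddAbove (y₂ '' Set.Icc 0 t)) →
        (∀ t₀ t : ℝ≥0, t₀ ≤ t →
          y₁ t ≤ β₁ (x₁ t₀) (t - t₀) + γ₁y (sSup (y₂ '' Set.Icc t₀ t)) + γ₁u U₁) →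
        (∀ t₀ t : ℝ≥0, t₀ ≤ t →
          y₂ t ≤ β₂ (x₂ t₀) (t - t₀) + γ₂y (sSup (y₁ '' Set.Icc t₀ t)) + γ₂u U₂) →
        (∀ t : ℝ≥0,
          x₁ t ≤ α₁0 (X₁ + sSup ((fun s => U₁ + y₁ s + y₂ s) '' Set.Icc 0 t))) →
        (∀ t : ℝ≥0,
          x₂ t ≤ α₂0 (X₂ + sSup ((fun s => U₂ + y₁ s + y₂ s) '' Set.Icc 0 t))) →
        x₁ 0 ≤ X₁ → x₂ 0 ≤ X₂ →
        (∀ t₀ t : ℝ≥0, t₀ ≤ t →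
          x₁ t ≤ βx1 (x₁ t₀) (t - t₀) + γx1y (sSup (y₂ '' Set.Icc t₀ t)) + γx1u U₁) →
        (∀ t₀ t : ℝ≥0, t₀ ≤ t →
          x₂ t ≤ βx2 (x₂ t₀) (t - t₀) + γx2y (sSup (y₁ '' Set.Icc t₀ t)) + γx2u U₂) →
        ∀ t : ℝ≥0, x₁ t + x₂ t ≤ βx (X₁ + X₂) t + γx (U₁ + U₂) := by
  have hi₁ := hρ₁.inv hρ₁invl hρ₁invr
  have hi₂ := hρ₂.inv hρ₂invl hρ₂invr
  let φ : ℝ≥0 → ℝ≥0 := fun a => a + ρ₁inv (2 * a) + γ₁y (a + ρ₂inv a)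
  have hφ : ClassK φ :=
    (ClassK.id'.add (hi₁.comp ClassK.id'.two)).add (hγ₁y.comp (ClassK.id'.add hi₂))
  let ψ : ℝ≥0 → ℝ≥0 := fun a => a + γ₂y (φ a)
  have hψ : ClassK ψ := ClassK.id'.add (hγ₂y.comp hφ)
  let Θ : ℝ≥0 → ℝ≥0 := fun a => γx1y (ψ a) + γx2y (φ a)
  have hΘ : ClassK Θ := (hγx1y.comp hψ).add (hγx2y.comp hφ)
  let p : ℝ≥0 → ℝ≥0 := fun s => β₁ s 0 + β₂ s 0
  have hp : ClassK p := (hβ₁.1 0).add (hβ₂.1 0)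
  let q : ℝ≥0 → ℝ≥0 := fun s => βx1 s 0 + βx2 s 0
  have hq : ClassK q := (hβx1.1 0).add (hβx2.1 0)
  let g : ℝ≥0 → ℝ≥0 := fun s => γ₁u s + γ₂u s
  have hg : ClassK g := hγ₁u.add hγ₂u
  let h : ℝ≥0 → ℝ≥0 := fun s => γx1u s + γx2u s
  have hh : ClassK h := hγx1u.add hγx2u
  let σ : ℝ≥0 → ℝ≥0 := fun s => (q s + Θ (2 * p s)) + (Θ (2 * g s) + h s)
  have hσ : ClassK σ :=
    (hq.add (hΘ.comp hp.two)).add ((hΘ.comp hg.two).add hh)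
  let γx : ℝ≥0 → ℝ≥0 := fun s => 2 * σ s
  have hγx : ClassK γx := hσ.two
  -- the predicate: reduced trajectory
  let Tr : (ℝ≥0 → ℝ≥0) → (ℝ≥0 → ℝ≥0) → (ℝ≥0 → ℝ≥0) → (ℝ≥0 → ℝ≥0) → ℝ≥0 → ℝ≥0 → Prop :=
    fun x₁ x₂ y₁ y₂ X U =>
      (∀ t : ℝ≥0, BddAbove (y₁ '' Set.Icc 0 t)) ∧
      (∀ t₀ t : ℝ≥0, t₀ ≤ t →
          y₁ t ≤ β₁ (x₁ t₀) (t - t₀) + γ₁y (sSup (y₂ '' Set.Icc t₀ t)) + γ₁u U) ∧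
      (∀ t₀ t : ℝ≥0, t₀ ≤ t →
          y₂ t ≤ β₂ (x₂ t₀) (t - t₀) + γ₂y (sSup (y₁ '' Set.Icc t₀ t)) + γ₂u U) ∧
      x₁ 0 ≤ X ∧ x₂ 0 ≤ X ∧
      (∀ t₀ t : ℝ≥0, t₀ ≤ t →
          x₁ t ≤ βx1 (x₁ t₀) (t - t₀) + γx1y (sSup (y₂ '' Set.Icc t₀ t)) + γx1u U) ∧
      (∀ t₀ t : ℝ≥0, t₀ ≤ t →
          x₂ t ≤ βx2 (x₂ t₀) (t - t₀) + γx2y (sSup (y₁ '' Set.Icc t₀ t)) + γx2u U)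
  have step := one_step hγ₁y.mono hρ₁.1.mono hi₁.mono hi₂.mono hρ₁invl hρ₂invl hsg₂
  have hc : ∀ ε : ℝ≥0, 0 < ε → 0 < min (ρ₁ (ε / 2) / 2) (ε / 2) := by
    intro ε hε
    have h2 : 0 < ε / 2 := by positivity
    have := hρ₁.1.pos h2
    exact lt_min (by positivity) h2
  -- global bounds on the outputs
  have hY : ∀ x₁ x₂ y₁ y₂ X U, Tr x₁ x₂ y₁ y₂ X U → ∀ t,
      y₁ t ≤ φ (p X + g U) ∧ y₂ t ≤ ψ (p X + g U) := by
    rintro x₁ x₂ y₁ y₂ X U ⟨hb, hy1, hy2, hX1, hX2, hx1, hx2⟩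
    have k1 : ∀ t B, (∀ s, s ≤ t → y₂ s ≤ B) → y₁ t ≤ (p X + g U) + γ₁y B := by
      intro t B hB
      have e1 := hy1 0 t (zero_le)
      have e2 : β₁ (x₁ 0) (t - 0) ≤ β₁ X 0 :=
        ((hβ₁.1 _).mono hX1).trans ((hβ₁.2 X).1 (zero_le))
      have e3 : γ₁y (sSup (y₂ '' Set.Icc 0 t)) ≤ γ₁y B :=
        hγ₁y.mono (sup_le' fun s _ hs => hB s hs)
      calc y₁ t ≤ β₁ X 0 + γ₁y B + γ₁u U := e1.trans (by gcongr)
        _ ≤ β₁ X 0 + γ₁y B + γ₁u U + (β₂ X 0 + γ₂u U) := le_self_add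
        _ = _ := by simp only [p, g]; ring
    have k2 : ∀ t B, (∀ s, s ≤ t → y₁ s ≤ B) → y₂ t ≤ (p X + g U) + γ₂y B := by
      intro t B hB
      have e1 := hy2 0 t (zero_le)
      have e2 : β₂ (x₂ 0) (t - 0) ≤ β₂ X 0 :=
        ((hβ₂.1 _).mono hX2).trans ((hβ₂.2 X).1 (zero_le))
      have e3 : γ₂y (sSup (y₁ '' Set.Icc 0 t)) ≤ γ₂y B :=
        hγ₂y.mono (sup_le' fun s _ hs => hB s hs)
      calc y₂ t ≤ β₂ X 0 + γ₂y B + γ₂u U := e1.trans (by gcongr)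
        _ ≤ β₂ X 0 + γ₂y B + γ₂u U + (β₁ X 0 + γ₁u U) := le_self_add
        _ = _ := by simp only [p, g]; ring
    have m1 : ∀ t, y₁ t ≤ φ (p X + g U) := by
      intro t
      set Y := sSup (y₁ '' Set.Icc 0 t) with hYdef
      have hle : ∀ s, s ≤ t → y₁ s ≤ Y := fun s hs =>
        le_csSup (hb t) ⟨s, ⟨zero_le, hs⟩, rfl⟩
      have hYle : Y ≤ (p X + g U) + γ₁y ((p X + g U) + γ₂y Y) := by
        apply sup_le'
        intro s _ hs
        apply k1
        intro s' hs'
        apply k2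
        intro s'' hs''
        exact hle _ (hs''.trans (hs'.trans hs))
      refine (hle t le_rfl).trans ?_
      apply le_of_forall_pos_le_add
      intro ε hε
      have := step _ ε Y Y hYle
      rcases le_max_iff.1 this with h' | h'
      · exact h'.trans le_self_add
      rcases le_max_iff.1 h' with h' | h'
      · exact h'.trans le_add_self
      · have hcp := hc ε hε
        by_contra hcon
        have hYp : 0 < Y := lt_of_le_of_lt (zero_le) (not_le.1 hcon)
        exact absurd h' (not_le.2 (tsub_lt_self hYp hcp))
    exact fun t => ⟨m1 t, k2 t _ fun s _ => m1 s⟩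
  -- global bound on the state
  have hXb : ∀ x₁ x₂ y₁ y₂ X U, Tr x₁ x₂ y₁ y₂ X U → ∀ t, x₁ t + x₂ t ≤ σ X + σ U := by
    intro x₁ x₂ y₁ y₂ X U hT t
    have hy := hY _ _ _ _ _ _ hT
    obtain ⟨hb, hy1, hy2, hX1, hX2, hx1, hx2⟩ := hT
    have e1 := hx1 0 t (zero_le)
    have e2 := hx2 0 t (zero_le)
    have e3 : βx1 (x₁ 0) (t - 0) ≤ βx1 X 0 :=
      ((hβx1.1 _).mono hX1).trans ((hβx1.2 X).1 (zero_le))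
    have e4 : βx2 (x₂ 0) (t - 0) ≤ βx2 X 0 :=
      ((hβx2.1 _).mono hX2).trans ((hβx2.2 X).1 (zero_le))
    have e5 := hγx1y.mono (sup_le' (a := 0) (b := t) fun s _ _ => (hy s).2)
    have e6 := hγx2y.mono (sup_le' (a := 0) (b := t) fun s _ _ => (hy s).1)
    calc x₁ t + x₂ t ≤ (βx1 X 0 + γx1y (ψ (p X + g U)) + γx1u U)
          + (βx2 X 0 + γx2y (φ (p X + g U)) + γx2u U) := by
          refine (add_le_add e1 e2).trans ?_
          gcongr
      _ = q X + Θ (p X + g U) + h U := by simp only [q, Θ, h]; ring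
      _ ≤ q X + (Θ (2 * p X) + Θ (2 * g U)) + h U := by
          have := hΘ.split (p X) (g U)
          gcongr
      _ = (q X + Θ (2 * p X)) + (Θ (2 * g U) + h U) := by ring
      _ ≤ σ X + σ U := add_le_add le_self_add le_add_self
  -- the predicate for the majorant
  let P : ℝ≥0 → ℝ≥0 → ℝ≥0 → Prop := fun r t v =>
    ∃ x₁ x₂ y₁ y₂ U, Tr x₁ x₂ y₁ y₂ r U ∧ v = x₁ t + x₂ t - γx U
  have hP1 : ∀ r t v, P r t v → v ≤ σ r := by
    rintro r t v ⟨x₁, x₂, y₁, y₂, U, hT, rfl⟩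
    apply tsub_le_iff_right.2
    refine (hXb _ _ _ _ _ _ hT t).trans ?_
    simp only [γx, two_mul]
    gcongr
    exact le_self_add
  have hP2 : ∀ R ε, 0 < ε → ∃ T, ∀ r t v, r ≤ R → T ≤ t → P r t v → v ≤ ε := by
    intro R η hη
    obtain ⟨δ, hδ, hδη⟩ := (ClassK.id'.two.add (hΘ.comp ClassK.id'.two)).small hη
    let M := σ R + σ R
    let B := φ (p R + g R)
    obtain ⟨T1, hT1⟩ := hβ₁.small M hδ
    obtain ⟨T2, hT2⟩ := hβ₂.small M hδ
    obtain ⟨T3, hT3⟩ := hβx1.small M hδ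
    obtain ⟨T4, hT4⟩ := hβx2.small M hδ
    let T := T1 + T2 + T3 + T4
    have l1 : T1 ≤ T := by simp only [T, add_assoc]; exact le_self_add
    have l2 : T2 ≤ T := by
      simp only [T]; exact le_add_self.trans (le_self_add.trans le_self_add)
    have l3 : T3 ≤ T := by
      simp only [T]; exact le_add_self.trans le_self_add
    have l4 : T4 ≤ T := le_add_self
    let ε := φ δ
    have hε : 0 < ε := hφ.pos hδ
    let c := min (ρ₁ (ε / 2) / 2) (ε / 2)
    have hcp : 0 < c := hc ε hε
    obtain ⟨N, hN⟩ := Archimedean.arch B hcp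
    refine ⟨N • (T + T) + T + T, ?_⟩
    rintro r t v hr ht ⟨x₁, x₂, y₁, y₂, U, hT, rfl⟩
    rcases le_total r U with hrU | hrU
    · have e1 := hXb _ _ _ _ _ _ hT t
      have e2 := hσ.mono hrU
      have : x₁ t + x₂ t ≤ γx U := by
        simp only [γx, two_mul]
        exact e1.trans (by gcongr)
      rw [tsub_eq_zero_of_le this]
      exact zero_le
    have hy := hY _ _ _ _ _ _ hT
    have hxb := hXb _ _ _ _ _ _ hT
    have hM : ∀ s, x₁ s + x₂ s ≤ M := fun s =>
      (hxb s).trans (add_le_add (hσ.mono hr) (hσ.mono (hrU.trans hr)))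
    have hM1 : ∀ s, x₁ s ≤ M := fun s => le_self_add.trans (hM s)
    have hM2 : ∀ s, x₂ s ≤ M := fun s => le_add_self.trans (hM s)
    have hB : ∀ s, y₁ s ≤ B := fun s => (hy s).1.trans
      (hφ.mono (add_le_add (hp.mono hr) (hg.mono (hrU.trans hr))))
    obtain ⟨hb, hy1, hy2, hX1, hX2, hx1, hx2⟩ := hT
    let a := δ + g U
    have k1 : ∀ τ C, (∀ s, τ ≤ s → y₂ s ≤ C) → ∀ s, τ + T ≤ s → y₁ s ≤ a + γ₁y C := by
      intro τ C hC s hs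
      have e1 := hy1 τ s (le_self_add.trans hs)
      have e2 := hT1 (x₁ τ) (s - τ) (hM1 τ) (l1.trans (le_tsub_of_add_le_left hs))
      have e3 := hγ₁y.mono (sup_le' (a := τ) (b := s) fun s h1 _ => hC s h1)
      calc y₁ s ≤ δ + γ₁y C + γ₁u U := e1.trans (by gcongr)
        _ ≤ δ + γ₁y C + γ₁u U + γ₂u U := le_self_add
        _ = _ := by simp only [a, g]; ring
    have k2 : ∀ τ C, (∀ s, τ ≤ s → y₁ s ≤ C) → ∀ s, τ + T ≤ s → y₂ s ≤ a + γ₂y C := by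
      intro τ C hC s hs
      have e1 := hy2 τ s (le_self_add.trans hs)
      have e2 := hT2 (x₂ τ) (s - τ) (hM2 τ) (l2.trans (le_tsub_of_add_le_left hs))
      have e3 := hγ₂y.mono (sup_le' (a := τ) (b := s) fun s h1 _ => hC s h1)
      calc y₂ s ≤ δ + γ₂y C + γ₂u U := e1.trans (by gcongr)
        _ ≤ δ + γ₂y C + γ₂u U + γ₁u U := le_self_add
        _ = _ := by simp only [a, g]; ring
    have hεa : ε ≤ φ a := hφ.mono le_self_add
    have it : ∀ n : ℕ, ∀ s, n • (T + T) ≤ s → y₁ s ≤ max (φ a) (B - n • c) := by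
      intro n
      induction n with
      | zero => intro s _; exact le_max_of_le_right (by simpa using hB s)
      | succ n ih =>
        intro s hs
        have hs' : n • (T + T) + T + T ≤ s := by
          rw [succ_nsmul, ← add_assoc] at hs
          exact hs
        have := step a ε _ _ (k1 _ _ (k2 _ _ ih) s hs')
        refine this.trans (max_le (le_max_left _ _) (max_le (hεa.trans (le_max_left _ _)) ?_))
        apply tsub_le_iff_right.2
        refine max_le ((le_max_left _ _).trans le_self_add) ?_
        calc B - n • c ≤ (B - (n + 1) • c) + c := by
              rw [succ_nsmul, ← tsub_tsub]
              exact le_tsub_add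
          _ ≤ _ := by
              gcongr
              exact le_max_right _ _
    have f1 : ∀ s, N • (T + T) ≤ s → y₁ s ≤ φ a := by
      intro s hs
      have := it N s hs
      rwa [tsub_eq_zero_of_le hN, max_eq_left (zero_le)] at this
    have f2 : ∀ s, N • (T + T) + T ≤ s → y₂ s ≤ ψ a := k2 _ _ f1
    set τ := N • (T + T) + T with hτ
    have hτt : τ ≤ t := le_self_add.trans ht
    have hTt : T ≤ t - τ := le_tsub_of_add_le_left ht
    have e1 := hx1 τ t hτt
    have e2 := hx2 τ t hτt
    have e3 := hT3 (x₁ τ) (t - τ) (hM1 τ) (l3.trans hTt)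
    have e4 := hT4 (x₂ τ) (t - τ) (hM2 τ) (l4.trans hTt)
    have e5 := hγx1y.mono (sup_le' (a := τ) (b := t) fun s h1 _ => f2 s h1)
    have e6 := hγx2y.mono (sup_le' (a := τ) (b := t) fun s h1 _ => f1 s (le_self_add.trans h1))
    apply tsub_le_iff_right.2
    calc x₁ t + x₂ t ≤ (δ + γx1y (ψ a) + γx1u U) + (δ + γx2y (φ a) + γx2u U) := by
          refine (add_le_add e1 e2).trans ?_
          gcongr
      _ = 2 * δ + Θ (δ + g U) + h U := by simp only [Θ, h, a]; ring
      _ ≤ 2 * δ + (Θ (2 * δ) + Θ (2 * g U)) + h U := by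
          have := hΘ.split δ (g U)
          gcongr
      _ = (2 * δ + Θ (2 * δ)) + (Θ (2 * g U) + h U) := by ring
      _ ≤ η + σ U := add_le_add hδη le_add_self
      _ ≤ η + γx U := by
          simp only [γx, two_mul]
          gcongr
          exact le_self_add
  obtain ⟨βx, hβx, hβP⟩ := kl_majorant P σ hσ hP1 hP2
  refine ⟨βx, γx, hβx, hγx, ?_⟩
  intro x₁ x₂ y₁ y₂ X₁ X₂ U₁ U₂ hbd hy1 hy2 _ _ hX1 hX2 hx1 hx2 t
  apply tsub_le_iff_right.1
  apply hβP
  refine ⟨x₁, x₂, y₁, y₂, U₁ + U₂, ⟨fun t => (hbd t).2.2.1, ?_, ?_, hX1.trans le_self_add,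
    hX2.trans le_add_self, ?_, ?_⟩, rfl⟩
  · intro t₀ t ht
    exact (hy1 t₀ t ht).trans (add_le_add le_rfl (hγ₁u.mono le_self_add))
  · intro t₀ t ht
    exact (hy2 t₀ t ht).trans (add_le_add le_rfl (hγ₂u.mono le_add_self))
  · intro t₀ t ht
    exact (hx1 t₀ t ht).trans (add_le_add le_rfl (hγx1u.mono le_self_add))
  · intro t₀ t ht
    exact (hx2 t₀ t ht).trans (add_le_add le_rfl (hγx2u.mono le_add_self))
end
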